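/- arXiv:0907.4279 — 4 statements merged into one kernel-verified Lean document; each statement's English description precedes it below -/
import Mathlib

section
/- Consider a weight sequence scheme satisfying conditions (b) and (c), and assume in addition that for each n the weights are ordered decreasingly, w_1 ≥ w_2 ≥ … ≥ w_n. Then for every s > 0, max over subsets S ⊆ [n] with |S| ≤ s n^{2/3} of | (∑_{j ∉ S} w_j³) / (∑_{j ∉ S} w_j) − σ₃/μ | converges to 0 as n → ∞. -/
open MeasureTheory ProbabilityTheory Filter Set
open scoped ENNReal Topology

/-- Truncated layer-cake formula. -/
theorem integral_min_eq_integral_measureReal_lt {α : Type*} [MeasurableSpace α] (μ : Measure α)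
    [IsFiniteMeasure μ] {X : α → ℝ} (hX : Measurable X) (hX0 : ∀ a, 0 ≤ X a) {K : ℝ}
    (hK : 0 ≤ K) :
    ∫ a, min (X a) K ∂μ = ∫ t in Ioo 0 K, μ.real {a | t < X a} := by
  have hint : Integrable (fun a => min (X a) K) μ :=
    Integrable.of_bound (hX.min measurable_const).aestronglyMeasurable K
      (Eventually.of_forall fun a => by
        rw [Real.norm_of_nonneg (le_min (hX0 a) hK)]
        exact min_le_right _ _)
  rw [hint.integral_eq_integral_meas_lt (Eventually.of_forall fun a => le_min (hX0 a) hK),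
    ← Ioi_inter_Iio, ← setIntegral_indicator measurableSet_Iio]
  refine setIntegral_congr_fun measurableSet_Ioi fun t _ => ?_
  by_cases ht : t < K <;> simp [ht]

/-- If the tails of the empirical distributions of `x n` converge almost everywhere to the tail
of `X`, then the truncated empirical means converge to the truncated mean. -/
theorem tendsto_average_min (x : ∀ n : ℕ, Fin n → ℝ) (hx : ∀ n i, 0 ≤ x n i)
    {Ω : Type*} [MeasurableSpace Ω] (P : Measure Ω) [IsFiniteMeasure P] {X : Ω → ℝ}
    (hX : Measurable X) (hX0 : ∀ a, 0 ≤ X a)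
    (h : ∀ᵐ t : ℝ, 0 < t → Tendsto
      (fun n : ℕ => ((Finset.univ.filter fun i : Fin n => t < x n i).card : ℝ) / n)
      atTop (𝓝 (P.real {a | t < X a}))) {K : ℝ} (hK : 0 ≤ K) :
    Tendsto (fun n : ℕ => (∑ i, min (x n i) K) / n) atTop (𝓝 (∫ a, min (X a) K ∂P)) := by
  have key (n : ℕ) : (∑ i, min (x n i) K) / n
      = ∫ t in Ioo 0 K, ((Finset.univ.filter fun i : Fin n => t < x n i).card : ℝ) / n := by
    have := integral_min_eq_integral_measureReal_lt (Measure.count : Measure (Fin n))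
      (X := x n) (measurable_of_countable _) (hx n) hK
    rw [integral_count] at this
    rw [this, ← integral_div]
    refine integral_congr_ae (Eventually.of_forall fun t => ?_)
    simp only
    congr 1
    rw [measureReal_def, ← Finset.coe_filter_univ, Measure.count_apply_finset]
    rfl
  simp_rw [key, integral_min_eq_integral_measureReal_lt P hX hX0 hK]
  refine tendsto_integral_of_dominated_convergence (fun _ => 1) (fun n => ?_) ?_
    (fun n => Eventually.of_forall fun t => ?_) ?_
  · refine (Antitone.measurable fun a b hab => ?_).aestronglyMeasurable
    gcongr
  · simp
  · rw [Real.norm_of_nonneg (by positivity)]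
    refine div_le_one_of_le₀ ?_ (by positivity)
    exact_mod_cast (Finset.card_le_univ _).trans_eq (Fintype.card_fin n)
  · rw [ae_restrict_iff' measurableSet_Ioo]
    filter_upwards [h] with t ht hmem using ht hmem.1

/-- Convergence of distribution functions at continuity points gives almost everywhere
convergence of the tails of the cubes. -/
theorem ae_tendsto_tail_cube (w : ∀ n : ℕ, Fin n → ℝ) {Ω : Type*} [MeasurableSpace Ω]
    (P : Measure Ω) [IsProbabilityMeasure P] {W : Ω → ℝ} (hW : Measurable W)
    (hb : ∀ x : ℝ, ContinuousAt (fun y => (P {ω | W ω ≤ y}).toReal) x →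
      Tendsto (fun n : ℕ =>
          ((Finset.univ.filter fun i : Fin n => w n i ≤ x).card : ℝ) / n)
        atTop (𝓝 ((P {ω | W ω ≤ x}).toReal))) :
    ∀ᵐ t : ℝ, 0 < t → Tendsto
      (fun n : ℕ => ((Finset.univ.filter fun i : Fin n => t < (w n i) ^ 3).card : ℝ) / n)
      atTop (𝓝 (P.real {a | t < (W a) ^ 3})) := by
  have hmono : Monotone (fun y => (P {ω | W ω ≤ y}).toReal) := fun a b hab =>
    measureReal_mono (μ := P) fun ω (hω : W ω ≤ a) => hω.trans hab
  filter_upwards [(hmono.countable_not_continuousAt.image (fun x => x ^ 3)).ae_notMem volume]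
    with t ht ht0
  obtain ⟨r, rfl⟩ : ∃ r : ℝ, r ^ 3 = t :=
    ⟨t ^ ((3 : ℕ) : ℝ)⁻¹, Real.rpow_inv_natCast_pow ht0.le (by norm_num)⟩
  have hr : ContinuousAt (fun y => (P {ω | W ω ≤ y}).toReal) r := by
    by_contra hr
    exact ht ⟨r, hr, rfl⟩
  have hlt (y : ℝ) : r ^ 3 < y ^ 3 ↔ ¬ y ≤ r := by
    rw [(Odd.strictMono_pow (by decide : Odd 3)).lt_iff_lt, not_le]
  simp_rw [hlt]
  have hP : P.real {a | ¬ W a ≤ r} = 1 - (P {ω | W ω ≤ r}).toReal :=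
    probReal_compl_eq_one_sub (measurableSet_le hW measurable_const)
  rw [hP]
  refine ((hb r hr).const_sub 1).congr' ?_
  filter_upwards [eventually_gt_atTop 0] with n hn
  have hcard := Finset.card_filter_add_card_filter_not (s := (Finset.univ : Finset (Fin n)))
    (fun i => w n i ≤ r)
  rw [Finset.card_univ, Fintype.card_fin] at hcard
  have hn' : (n : ℝ) ≠ 0 := by positivity
  rw [eq_div_iff hn', sub_mul, div_mul_cancel₀ _ hn', one_mul, sub_eq_iff_eq_add']
  exact_mod_cast hcard.symm

/-- Truncations of an integrable function converge in mean. -/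
theorem exists_integral_sub_lt_integral_min {Ω : Type*} [MeasurableSpace Ω] (P : Measure Ω)
    {X : Ω → ℝ} (hX : Integrable X P) (hX0 : ∀ a, 0 ≤ X a) {δ : ℝ} (hδ : 0 < δ) :
    ∃ K : ℝ, 0 ≤ K ∧ ∫ a, X a ∂P - δ < ∫ a, min (X a) K ∂P := by
  have h : Tendsto (fun k : ℕ => ∫ a, min (X a) k ∂P) atTop (𝓝 (∫ a, X a ∂P)) := by
    refine tendsto_integral_of_dominated_convergence X
      (fun k => hX.aestronglyMeasurable.inf aestronglyMeasurable_const) hX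
      (fun k => Eventually.of_forall fun a => ?_) (Eventually.of_forall fun a => ?_)
    · rw [Real.norm_of_nonneg (le_min (hX0 a) k.cast_nonneg)]
      exact min_le_left _ _
    · refine tendsto_const_nhds.congr' ?_
      filter_upwards [eventually_ge_atTop ⌈X a⌉₊] with k hk
      exact (min_eq_left (Nat.ceil_le.1 hk)).symm
  obtain ⟨k, hk⟩ := (h.eventually_const_lt (sub_lt_self _ hδ)).exists
  exact ⟨k, k.cast_nonneg, hk⟩

/-- Uniform integrability: if the averages and the truncated averages of `x n` converge to the
corresponding means of `X`, then sets of size `O(n ^ (2/3))` carry a vanishing part of the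
average. -/
theorem eventually_sum_small_set_div_lt (x : ∀ n : ℕ, Fin n → ℝ)
    {Ω : Type*} [MeasurableSpace Ω] (P : Measure Ω) {X : Ω → ℝ} (hX : Integrable X P)
    (hX0 : ∀ a, 0 ≤ X a)
    (hmean : Tendsto (fun n : ℕ => (∑ i, x n i) / n) atTop (𝓝 (∫ a, X a ∂P)))
    (hmin : ∀ K : ℝ, 0 ≤ K →
      Tendsto (fun n : ℕ => (∑ i, min (x n i) K) / n) atTop (𝓝 (∫ a, min (X a) K ∂P)))
    (s : ℝ) {δ : ℝ} (hδ : 0 < δ) :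
    ∀ᶠ n : ℕ in atTop, ∀ S : Finset (Fin n), (S.card : ℝ) ≤ s * (n : ℝ) ^ (2/3 : ℝ) →
      (∑ i ∈ S, x n i) / n < δ := by
  obtain ⟨K, hK0, hK⟩ := exists_integral_sub_lt_integral_min P hX hX0 (half_pos hδ)
  have hsize : Tendsto (fun n : ℕ => K * (s * (n : ℝ) ^ (-(1/3) : ℝ))) atTop (𝓝 0) := by
    simpa using (((tendsto_rpow_neg_atTop (by norm_num : (0:ℝ) < 1/3)).comp
      tendsto_natCast_atTop_atTop).const_mul s).const_mul K
  have hlim := (hmean.sub (hmin K hK0)).add hsize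
  filter_upwards [hlim.eventually_lt_const (show _ < δ by linarith), eventually_gt_atTop 0]
    with n hn hn0 S hS
  refine lt_of_le_of_lt ?_ hn
  have hn' : (0 : ℝ) < n := by exact_mod_cast hn0
  have hpow : (n : ℝ) ^ (2/3 : ℝ) = (n : ℝ) ^ (-(1/3) : ℝ) * n := by
    rw [← Real.rpow_add_one hn'.ne']
    norm_num
  have htrunc : ∑ i ∈ S, x n i - ∑ i ∈ S, min (x n i) K
      ≤ ∑ i, x n i - ∑ i, min (x n i) K := by
    rw [← Finset.sum_sub_distrib, ← Finset.sum_sub_distrib]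
    exact Finset.sum_le_univ_sum_of_nonneg fun i => sub_nonneg.2 (min_le_left _ _)
  have hbdd : ∑ i ∈ S, min (x n i) K ≤ K * S.card := by
    rw [mul_comm, ← nsmul_eq_mul]
    exact Finset.sum_le_card_nsmul _ _ _ fun i _ => min_le_right _ _
  have hsmall : K * S.card ≤ K * (s * (n : ℝ) ^ (-(1/3) : ℝ)) * n := by
    rw [mul_assoc, mul_assoc, ← hpow]
    gcongr
  rw [← sub_div, div_le_iff₀ hn', add_mul, div_mul_cancel₀ _ hn'.ne']
  linarith

/-- Under conditions (b) and (c), with decreasingly ordered weights, for every `s > 0` the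
maximum over subsets `S ⊆ [n]` with `|S| ≤ s n^{2/3}` of
`|(∑_{j ∉ S} w j³)/(∑_{j ∉ S} w j) - σ₃/μ|` converges to `0` as `n → ∞`,
where `μ = E[W]` and `σ₃ = E[W³]`. -/
theorem depleted_weight_ratio_convergence
    -- the weight sequence scheme
    (w : ∀ n : ℕ, Fin n → ℝ) (hwpos : ∀ n (i : Fin n), 0 < w n i)
    -- the limiting random variable W
    {Ω₀ : Type*} [MeasurableSpace Ω₀] (P₀ : Measure Ω₀) [IsProbabilityMeasure P₀]
    (W : Ω₀ → ℝ) (hWmeas : Measurable W) (hWnn : ∀ ω, 0 ≤ W ω)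
    (hW1 : Integrable W P₀) (hW2 : Integrable (fun ω => W ω ^ 2) P₀)
    (hW3 : Integrable (fun ω => W ω ^ 3) P₀)
    (hμpos : 0 < ∫ ω, W ω ∂P₀)
    -- condition (b): weak convergence of the weight of a uniform vertex
    (hb : ∀ x : ℝ, ContinuousAt (fun y => (P₀ {ω | W ω ≤ y}).toReal) x →
      Tendsto (fun n : ℕ =>
          ((Finset.univ.filter fun i : Fin n => w n i ≤ x).card : ℝ) / n)
        atTop (𝓝 ((P₀ {ω | W ω ≤ x}).toReal)))
    -- condition (c): convergence of the first three moments
    (hc1 : (fun n : ℕ => (∑ i : Fin n, w n i) / n - ∫ ω, W ω ∂P₀)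
      =o[atTop] fun n : ℕ => (n : ℝ) ^ (-(1/3 : ℝ)))
    (hc2 : (fun n : ℕ => (∑ i : Fin n, (w n i) ^ 2) / n - ∫ ω, W ω ^ 2 ∂P₀)
      =o[atTop] fun n : ℕ => (n : ℝ) ^ (-(1/3 : ℝ)))
    (hc3 : Tendsto (fun n : ℕ => (∑ i : Fin n, (w n i) ^ 3) / n) atTop
      (𝓝 (∫ ω, W ω ^ 3 ∂P₀)))
    -- the weights are ordered decreasingly
    (hdec : ∀ n : ℕ, ∀ i j : Fin n, i ≤ j → w n j ≤ w n i) :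
    ∀ s : ℝ, 0 < s → ∀ ε : ℝ, 0 < ε → ∃ N : ℕ, ∀ n ≥ N, ∀ S : Finset (Fin n),
      (S.card : ℝ) ≤ s * (n : ℝ) ^ (2/3 : ℝ) →
        |(∑ j ∈ Sᶜ, (w n j) ^ 3) / (∑ j ∈ Sᶜ, w n j)
            - (∫ ω, W ω ^ 3 ∂P₀) / ∫ ω, W ω ∂P₀| < ε := by
  intro s hs ε hε
  have hmean : Tendsto (fun n : ℕ => (∑ i : Fin n, w n i) / n) atTop (𝓝 (∫ ω, W ω ∂P₀)) := by
    have hrate : Tendsto (fun n : ℕ => (n : ℝ) ^ (-(1/3 : ℝ))) atTop (𝓝 0) :=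
      (tendsto_rpow_neg_atTop (by norm_num)).comp tendsto_natCast_atTop_atTop
    simpa using (hc1.trans_tendsto hrate).add_const (∫ ω, W ω ∂P₀)
  have hW0 : ∀ ω, 0 ≤ W ω ^ 3 := fun ω => pow_nonneg (hWnn ω) 3
  have hw0 : ∀ n (i : Fin n), 0 ≤ w n i ^ 3 := fun n i => (pow_pos (hwpos n i) 3).le
  have hsmall {δ : ℝ} (hδ : 0 < δ) := eventually_sum_small_set_div_lt (fun n i => w n i ^ 3) P₀
    hW3 hW0 hc3 (fun K hK => tendsto_average_min _ hw0 P₀ (hWmeas.pow_const 3) hW0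
      (ae_tendsto_tail_cube w P₀ hWmeas hb) hK) s hδ
  have hsize : Tendsto (fun n : ℕ => s * (n : ℝ) ^ (-(1/3) : ℝ)) atTop (𝓝 0) := by
    simpa using ((tendsto_rpow_neg_atTop (by norm_num : (0:ℝ) < 1/3)).comp
      tendsto_natCast_atTop_atTop).const_mul s
  have hdiv : ContinuousAt (fun p : ℝ × ℝ => p.1 / p.2) (∫ ω, W ω ^ 3 ∂P₀, ∫ ω, W ω ∂P₀) :=
    continuousAt_fst.div continuousAt_snd hμpos.ne'
  obtain ⟨η, hη, hball⟩ := Metric.continuousAt_iff.1 hdiv ε hε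
  rw [← eventually_atTop]
  have hη3 : 0 < η / 3 := by positivity
  filter_upwards [hsmall hη3, hsize.eventually_lt_const hη3, eventually_gt_atTop 0,
    Metric.tendsto_nhds.1 hmean _ hη3, Metric.tendsto_nhds.1 hc3 _ hη3]
    with n hn hn_size hn0 hn1 hn3 S hS
  have hn' : (0 : ℝ) < n := by exact_mod_cast hn0
  have hcube := hn S hS
  have hcube0 : 0 ≤ (∑ i ∈ S, w n i ^ 3) / n :=
    div_nonneg (Finset.sum_nonneg fun i _ => hw0 n i) hn'.le
  have hlin0 : 0 ≤ (∑ i ∈ S, w n i) / n :=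
    div_nonneg (Finset.sum_nonneg fun i _ => (hwpos n i).le) hn'.le
  have hlin : (∑ i ∈ S, w n i) / n ≤ (∑ i ∈ S, w n i ^ 3) / n + S.card / n := by
    rw [← add_div]
    gcongr
    rw [Finset.cast_card, ← Finset.sum_add_distrib]
    refine Finset.sum_le_sum fun i _ => ?_
    nlinarith [hwpos n i, sq_nonneg (w n i - 1), mul_nonneg (hwpos n i).le (sq_nonneg (w n i - 1))]
  have hcard : (S.card : ℝ) / n ≤ s * (n : ℝ) ^ (-(1/3) : ℝ) := by
    rw [div_le_iff₀ hn', mul_assoc, ← Real.rpow_add_one hn'.ne']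
    norm_num at hS ⊢
    exact hS
  rw [Real.dist_eq, abs_lt] at hn1 hn3
  have hsplit (f : Fin n → ℝ) : (∑ i ∈ Sᶜ, f i) / n = (∑ i, f i) / n - (∑ i ∈ S, f i) / n := by
    rw [← Finset.sum_add_sum_compl S f]
    ring
  have hdist : dist ((∑ j ∈ Sᶜ, w n j ^ 3) / n, (∑ j ∈ Sᶜ, w n j) / n)
      (∫ ω, W ω ^ 3 ∂P₀, ∫ ω, W ω ∂P₀) < η := by
    rw [Prod.dist_eq, max_lt_iff, Real.dist_eq, Real.dist_eq, abs_lt, abs_lt, hsplit, hsplit]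
    refine ⟨⟨?_, ?_⟩, ?_, ?_⟩ <;> linarith
  have hratio := hball hdist
  rwa [Real.dist_eq, div_div_div_cancel_right₀ hn'.ne'] at hratio
end

section
/- (Conditions (b) and (c) imply condition (a).) Consider a weight sequence scheme satisfying conditions (b) and (c). Then the maximal weight satisfies max_{i ∈ [n]} w_i = o(n^{1/3}), i.e. n^{−1/3} max_{i ∈ [n]} w_i → 0 as n → ∞. -/
open MeasureTheory ProbabilityTheory Filter Set
open scoped ENNReal Topology

/-- Layer cake formula for the third moment. -/
lemma lintegral_ofReal_pow_three_eq {α : Type*} [MeasurableSpace α] (μ : Measure α) {X : α → ℝ}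
    (hX : Measurable X) (hX0 : ∀ a, 0 ≤ X a) :
    ∫⁻ a, ENNReal.ofReal (X a ^ 3) ∂μ =
      ∫⁻ t in Ioi (0 : ℝ), μ {a | t < X a} * ENNReal.ofReal (3 * t ^ 2) := by
  have h := lintegral_comp_eq_lintegral_meas_lt_mul μ (f := X) (g := fun t => 3 * t ^ 2)
    (Eventually.of_forall hX0) hX.aemeasurable
    (fun t _ => (by fun_prop : Continuous fun t : ℝ => 3 * t ^ 2).intervalIntegrable _ _)
    (Eventually.of_forall fun t => by positivity)
  rw [← h]
  refine lintegral_congr fun a => ?_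
  congr 1
  rw [intervalIntegral.integral_const_mul, integral_pow]
  norm_num
  ring

/-- Fatou's lemma for third moments under a lower bound on the limiting tails. -/
lemma lintegral_ofReal_pow_three_le_liminf {Ω : Type*} [MeasurableSpace Ω] (P : Measure Ω)
    {W : Ω → ℝ} (hW : Measurable W) (hW0 : ∀ ω, 0 ≤ W ω)
    {α : ℕ → Type*} [∀ n, MeasurableSpace (α n)] (μ : ∀ n, Measure (α n)) {X : ∀ n, α n → ℝ}
    (hX : ∀ n, Measurable (X n)) (hX0 : ∀ n a, 0 ≤ X n a)
    (h : ∀ᵐ t ∂(volume.restrict (Ioi (0 : ℝ))),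
      P {ω | t < W ω} ≤ liminf (fun n => μ n {a | t < X n a}) atTop) :
    ∫⁻ ω, ENNReal.ofReal (W ω ^ 3) ∂P ≤
      liminf (fun n => ∫⁻ a, ENNReal.ofReal (X n a ^ 3) ∂(μ n)) atTop := by
  rw [lintegral_ofReal_pow_three_eq P hW hW0]
  simp_rw [fun n => lintegral_ofReal_pow_three_eq (μ n) (hX n) (hX0 n)]
  have hmeas : ∀ n, Measurable fun t : ℝ => μ n {a | t < X n a} * ENNReal.ofReal (3 * t ^ 2) := by
    intro n
    refine Measurable.mul (Antitone.measurable fun s t hst => ?_) (by fun_prop)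
    exact measure_mono fun a (ha : t < X n a) => hst.trans_lt ha
  refine le_trans (lintegral_mono_ae ?_) (lintegral_liminf_le hmeas)
  filter_upwards [h] with t ht
  calc P {ω | t < W ω} * ENNReal.ofReal (3 * t ^ 2)
      ≤ liminf (fun n => μ n {a | t < X n a}) atTop * ENNReal.ofReal (3 * t ^ 2) := by gcongr
    _ = liminf (fun n => μ n {a | t < X n a} * ENNReal.ofReal (3 * t ^ 2)) atTop := by
      refine Monotone.map_liminf_of_continuousAt (f := fun x : ℝ≥0∞ =>
        x * ENNReal.ofReal (3 * t ^ 2)) (fun x y hxy => mul_le_mul_left hxy _) _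
        (ENNReal.continuous_mul_const ENNReal.ofReal_ne_top).continuousAt

/-- Resetting one value of `v` to zero lowers the number of values above `t` by at most one. -/
lemma card_filter_lt_update_zero {m : ℕ} (v : Fin m → ℝ) (i : Fin m) (t : ℝ) :
    (m : ℝ) - ((Finset.univ.filter fun j => v j ≤ t).card : ℝ) - 1 ≤
      ((Finset.univ.filter fun j => t < Function.update v i 0 j).card : ℝ) := by
  classical
  have h1 : (Finset.univ.filter fun j => v j ≤ t).card
      + (Finset.univ.filter fun j => ¬ v j ≤ t).card = m := by
    simpa using Finset.card_filter_add_card_filter_not (s := (Finset.univ : Finset (Fin m)))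
      (fun j => v j ≤ t)
  have h2 : (Finset.univ.filter fun j => ¬ v j ≤ t) ⊆
      insert i (Finset.univ.filter fun j => t < Function.update v i 0 j) := by
    intro j hj
    rcases eq_or_ne j i with rfl | hji
    · simp
    · simpa [hji] using hj
  have h3 := (Finset.card_le_card h2).trans (Finset.card_insert_le _ _)
  have h4 : m ≤ (Finset.univ.filter fun j => v j ≤ t).card +
      ((Finset.univ.filter fun j => t < Function.update v i 0 j).card + 1) := by omega
  have h5 : (m : ℝ) ≤ ((Finset.univ.filter fun j => v j ≤ t).card : ℝ) +
      (((Finset.univ.filter fun j => t < Function.update v i 0 j).card : ℝ) + 1) := by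
    exact_mod_cast h4
  linarith

/-- If the empirical distributions and third moments of a triangular array converge to those of
`W`, then no single row entry contributes to the limiting third moment. -/
lemma tendsto_pow_three_div_zero (v : ∀ n : ℕ, Fin (n + 1) → ℝ) (hv : ∀ n i, 0 ≤ v n i)
    (i : ∀ n, Fin (n + 1))
    {Ω : Type*} [MeasurableSpace Ω] (P : Measure Ω) [IsProbabilityMeasure P]
    (W : Ω → ℝ) (hW : Measurable W) (hW0 : ∀ ω, 0 ≤ W ω)
    (hW3 : Integrable (fun ω => W ω ^ 3) P)
    (hb : ∀ x : ℝ, ContinuousAt (fun y => (P {ω | W ω ≤ y}).toReal) x →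
      Tendsto (fun n : ℕ =>
          ((Finset.univ.filter fun i => v n i ≤ x).card : ℝ) / ((n : ℝ) + 1))
        atTop (𝓝 ((P {ω | W ω ≤ x}).toReal)))
    (hc : Tendsto (fun n : ℕ => (∑ i, (v n i) ^ 3) / ((n : ℝ) + 1)) atTop
      (𝓝 (∫ ω, W ω ^ 3 ∂P))) :
    Tendsto (fun n : ℕ => (v n (i n)) ^ 3 / ((n : ℝ) + 1)) atTop (𝓝 0) := by
  classical
  set X : ∀ n, Fin (n + 1) → ℝ := fun n => Function.update (v n) (i n) 0 with hXdef
  have hX0 : ∀ n j, 0 ≤ X n j := by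
    intro n j
    rcases eq_or_ne j (i n) with rfl | hj
    · simp [hXdef]
    · simpa [hXdef, hj] using hv n j
  have hsum : ∀ n, ∑ j, (v n j) ^ 3 = (v n (i n)) ^ 3 + ∑ j, (X n j) ^ 3 := by
    intro n
    rw [← Finset.add_sum_erase _ _ (Finset.mem_univ (i n)),
      ← Finset.add_sum_erase _ (fun j => X n j ^ 3) (Finset.mem_univ (i n))]
    have : ∑ j ∈ Finset.univ.erase (i n), X n j ^ 3
        = ∑ j ∈ Finset.univ.erase (i n), v n j ^ 3 :=
      Finset.sum_congr rfl fun j hj => by simp [hXdef, Finset.ne_of_mem_erase hj]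
    rw [this]
    simp [hXdef]
  let μ : ∀ n : ℕ, Measure (Fin (n + 1)) :=
    fun n => ENNReal.ofReal (1 / ((n : ℝ) + 1)) • Measure.count
  have hfatou := lintegral_ofReal_pow_three_le_liminf P hW hW0 μ (X := X)
    (fun n => measurable_of_finite _) hX0 (by
      have hmono : Monotone fun y => (P {ω | W ω ≤ y}).toReal := fun s t hst =>
        ENNReal.toReal_mono (measure_ne_top _ _)
          (measure_mono fun ω (hω : W ω ≤ s) => hω.trans hst)
      refine ae_restrict_of_ae ?_
      filter_upwards [hmono.countable_not_continuousAt.ae_notMem volume] with t ht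
      have hlim : Tendsto (fun n : ℕ => ENNReal.ofReal
          (1 - ((Finset.univ.filter fun i => v n i ≤ t).card : ℝ) / ((n : ℝ) + 1)
            - 1 / ((n : ℝ) + 1))) atTop (𝓝 (P {ω | t < W ω})) := by
        have h1 : P {ω | t < W ω} = ENNReal.ofReal (1 - (P {ω | W ω ≤ t}).toReal - 0) := by
          have hcompl : {ω | t < W ω} = {ω | W ω ≤ t}ᶜ := by ext; simp
          have := probReal_compl_eq_one_sub (μ := P) (measurableSet_le hW measurable_const :
            MeasurableSet {ω | W ω ≤ t})
          rw [sub_zero, hcompl, ← measureReal_def, ← this, ofReal_measureReal]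
        rw [h1]
        exact ENNReal.tendsto_ofReal (((tendsto_const_nhds).sub (hb t (by simpa using ht))).sub
          tendsto_one_div_add_atTop_nhds_zero_nat)
      rw [← hlim.liminf_eq]
      refine liminf_le_liminf (Eventually.of_forall fun n => ?_)
      have hcount : μ n {a | t < X n a} = ENNReal.ofReal
          (1 / ((n : ℝ) + 1) * ((Finset.univ.filter fun j => t < X n j).card : ℝ)) := by
        rw [ENNReal.ofReal_mul (by positivity), ENNReal.ofReal_natCast]
        simp only [μ, Measure.smul_apply, smul_eq_mul]
        congr 1
        rw [← Measure.count_apply_finset]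
        congr 1
        ext
        simp
      rw [hcount]
      refine ENNReal.ofReal_le_ofReal ?_
      have hn : (0 : ℝ) < (n : ℝ) + 1 := by positivity
      have h := card_filter_lt_update_zero (v n) (i n) t
      push_cast at h
      calc _ = 1 / ((n : ℝ) + 1) *
            ((n : ℝ) + 1 - ((Finset.univ.filter fun i => v n i ≤ t).card : ℝ) - 1) := by
            field_simp
        _ ≤ _ := by gcongr)
  have hint : ∀ n, ∫⁻ a, ENNReal.ofReal (X n a ^ 3) ∂(μ n)
      = ENNReal.ofReal ((∑ j, X n j ^ 3) / ((n : ℝ) + 1)) := by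
    intro n
    rw [div_eq_inv_mul, ENNReal.ofReal_mul (by positivity),
      ENNReal.ofReal_sum_of_nonneg fun j _ => pow_nonneg (hX0 n j) 3]
    simp [μ, lintegral_smul_measure, lintegral_count]
  simp_rw [hint] at hfatou
  rw [← ofReal_integral_eq_lintegral_ofReal hW3
    (Eventually.of_forall fun ω => pow_nonneg (hW0 ω) 3)] at hfatou
  set L := ∫ ω, W ω ^ 3 ∂P
  have hB : ∀ ε > 0, ∀ᶠ n : ℕ in atTop, L - ε < (∑ j, X n j ^ 3) / ((n : ℝ) + 1) := by
    intro ε hε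
    rcases lt_or_ge (L - ε) 0 with hneg | hnn
    · refine Eventually.of_forall fun n => hneg.trans_le ?_
      exact div_nonneg (Finset.sum_nonneg fun j _ => pow_nonneg (hX0 n j) 3) (by positivity)
    · have hlt : ENNReal.ofReal (L - ε) < ENNReal.ofReal L :=
        (ENNReal.ofReal_lt_ofReal_iff (by linarith)).2 (by linarith)
      filter_upwards [eventually_lt_of_lt_liminf (hlt.trans_le hfatou)] with n hn
      exact (ENNReal.ofReal_lt_ofReal_iff_of_nonneg hnn).1 hn
  refine tendsto_order.2 ⟨fun a ha => Eventually.of_forall fun n => ha.trans_le ?_, fun ε hε => ?_⟩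
  · exact div_nonneg (pow_nonneg (hv n _) 3) (by positivity)
  · filter_upwards [hB (ε / 2) (by positivity),
      hc.eventually (gt_mem_nhds (show L < L + ε / 2 by linarith))] with n h1 h2
    rw [hsum, add_div] at h2
    linarith

/-- Conditions (b) and (c) imply condition (a): the maximal weight satisfies
`max_{i ∈ [n]} w i = o(n^{1/3})`, i.e. `n^{-1/3} max_i w i → 0` as `n → ∞`. -/
theorem max_weight_little_o
    -- the weight sequence scheme
    (w : ∀ n : ℕ, Fin n → ℝ) (hwpos : ∀ n (i : Fin n), 0 < w n i)
    -- the limiting random variable W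
    {Ω₀ : Type*} [MeasurableSpace Ω₀] (P₀ : Measure Ω₀) [IsProbabilityMeasure P₀]
    (W : Ω₀ → ℝ) (hWmeas : Measurable W) (hWnn : ∀ ω, 0 ≤ W ω)
    (hW1 : Integrable W P₀) (hW2 : Integrable (fun ω => W ω ^ 2) P₀)
    (hW3 : Integrable (fun ω => W ω ^ 3) P₀)
    (hμpos : 0 < ∫ ω, W ω ∂P₀)
    -- condition (b): weak convergence of the weight of a uniform vertex
    (hb : ∀ x : ℝ, ContinuousAt (fun y => (P₀ {ω | W ω ≤ y}).toReal) x →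
      Tendsto (fun n : ℕ =>
          ((Finset.univ.filter fun i : Fin n => w n i ≤ x).card : ℝ) / n)
        atTop (𝓝 ((P₀ {ω | W ω ≤ x}).toReal)))
    -- condition (c): convergence of the first three moments
    (hc1 : (fun n : ℕ => (∑ i : Fin n, w n i) / n - ∫ ω, W ω ∂P₀)
      =o[atTop] fun n : ℕ => (n : ℝ) ^ (-(1/3 : ℝ)))
    (hc2 : (fun n : ℕ => (∑ i : Fin n, (w n i) ^ 2) / n - ∫ ω, W ω ^ 2 ∂P₀)
      =o[atTop] fun n : ℕ => (n : ℝ) ^ (-(1/3 : ℝ)))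
    (hc3 : Tendsto (fun n : ℕ => (∑ i : Fin n, (w n i) ^ 3) / n) atTop
      (𝓝 (∫ ω, W ω ^ 3 ∂P₀))) :
    Tendsto (fun n : ℕ => ⨆ i : Fin n, (n : ℝ) ^ (-(1/3 : ℝ)) * w n i)
      atTop (𝓝 0) := by
  rw [← tendsto_add_atTop_iff_nat 1]
  choose i hi using fun n : ℕ => exists_eq_ciSup_of_finite
    (f := fun i : Fin (n + 1) => ((n + 1 : ℕ) : ℝ) ^ (-(1/3 : ℝ)) * w (n + 1) i)
  have h := tendsto_pow_three_div_zero (fun n => w (n + 1)) (fun n i => (hwpos _ i).le) i P₀ W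
    hWmeas hWnn hW3
    (fun x hx => by simpa using (tendsto_add_atTop_iff_nat 1).2 (hb x hx))
    (by simpa using (tendsto_add_atTop_iff_nat 1).2 hc3)
  have h' := h.rpow_const (p := (1/3 : ℝ)) (Or.inr (by norm_num))
  rw [Real.zero_rpow (by norm_num)] at h'
  refine h'.congr fun n => ?_
  rw [← hi n]
  have hw := (hwpos (n + 1) (i n)).le
  push_cast
  rw [Real.div_rpow (by positivity) (by positivity), Real.rpow_neg (by positivity),
    ← Real.rpow_natCast, ← Real.rpow_mul hw]
  norm_num
  rw [div_eq_inv_mul]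
end

section
/- Consider a weight sequence scheme satisfying conditions (b) and (c), and assume in addition that for each n the weights are ordered decreasingly, w_1 ≥ w_2 ≥ … ≥ w_n. Then for every s > 0, the sum of the cubes of the largest ⌊s n^{2/3}⌋ weights is o(n), i.e. (1/n) ∑_{j=1}^{⌊s n^{2/3}⌋} w_j³ → 0 as n → ∞. -/
open MeasureTheory ProbabilityTheory Filter Set
open scoped ENNReal Topology

/-- Layer cake formula for the cube of a nonnegative function truncated at level `M`. -/
lemma integral_min_pow_three_eq {Ω : Type*} [MeasurableSpace Ω] (μ : Measure Ω)
    [IsFiniteMeasure μ] {X : Ω → ℝ} (hX : Measurable X) (hX0 : ∀ ω, 0 ≤ X ω)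
    {M : ℝ} (hM : 0 ≤ M) :
    ∫ ω, (min (X ω) M) ^ 3 ∂μ =
      ∫ t in Ioc 0 (M ^ 3), μ.real {ω | t < (min (X ω) M) ^ 3} := by
  have hnn : ∀ ω, 0 ≤ (min (X ω) M) ^ 3 := fun ω => pow_nonneg (le_min (hX0 ω) hM) 3
  have hle : ∀ ω, (min (X ω) M) ^ 3 ≤ M ^ 3 := fun ω =>
    pow_le_pow_left₀ (le_min (hX0 ω) hM) (min_le_right _ _) 3
  have hint : Integrable (fun ω => (min (X ω) M) ^ 3) μ := by
    refine Integrable.of_bound ((hX.min measurable_const).pow_const 3).aestronglyMeasurable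
      (M ^ 3) (Eventually.of_forall fun ω => ?_)
    rw [Real.norm_of_nonneg (hnn ω)]
    exact hle ω
  rw [hint.integral_eq_integral_Ioc_meas_le (Eventually.of_forall hnn)
    (Eventually.of_forall hle)]
  apply integral_congr_ae
  filter_upwards [meas_le_ae_eq_meas_lt μ (volume.restrict (Ioc 0 (M ^ 3)))
    fun ω => (min (X ω) M) ^ 3] with t ht
  exact congrArg ENNReal.toReal ht

lemma pow_three_lt_min_pow_three_iff {u x M : ℝ} (hu : 0 ≤ u) (huM : u < M) (hx : 0 ≤ x) :
    u ^ 3 < (min x M) ^ 3 ↔ u < x := by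
  rw [pow_lt_pow_iff_left₀ hu (le_min hx (hu.trans huM.le)) three_ne_zero, lt_min_iff]
  exact and_iff_left huM

/-- Convergence of the empirical distribution functions at continuity points implies convergence
of the averages of truncated cubes. -/
lemma tendsto_sum_min_pow_three_div
    (w : ∀ n : ℕ, Fin n → ℝ) (hw : ∀ n (i : Fin n), 0 ≤ w n i)
    {Ω : Type*} [MeasurableSpace Ω] (P : Measure Ω) [IsProbabilityMeasure P]
    (W : Ω → ℝ) (hWmeas : Measurable W) (hW : ∀ ω, 0 ≤ W ω)
    (hb : ∀ x : ℝ, ContinuousAt (fun y => (P {ω | W ω ≤ y}).toReal) x →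
      Tendsto (fun n : ℕ =>
          ((Finset.univ.filter fun i : Fin n => w n i ≤ x).card : ℝ) / n)
        atTop (𝓝 ((P {ω | W ω ≤ x}).toReal)))
    {M : ℝ} (hM : 0 ≤ M) :
    Tendsto (fun n : ℕ => (∑ i : Fin n, (min (w n i) M) ^ 3) / n) atTop
      (𝓝 (∫ ω, (min (W ω) M) ^ 3 ∂P)) := by
  have hsum : ∀ n : ℕ, (∑ i : Fin n, (min (w n i) M) ^ 3) / (n : ℝ) =
      ∫ t in Ioc 0 (M ^ 3),
        (Measure.count : Measure (Fin n)).real {i | t < (min (w n i) M) ^ 3} / n := by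
    intro n
    rw [integral_div, ← integral_min_pow_three_eq _ (measurable_of_finite _) (hw n) hM,
      integral_count]
  simp_rw [hsum]
  rw [integral_min_pow_three_eq P hWmeas hW hM]
  have hmono : Monotone fun y => (P {ω | W ω ≤ y}).toReal := fun a b hab =>
    ENNReal.toReal_mono (measure_ne_top _ _) (measure_mono fun ω hω => le_trans hω hab)
  have hcount := hmono.countable_not_continuousAt
  refine tendsto_integral_of_dominated_convergence (fun _ => (1 : ℝ)) (fun n => ?_)
    (integrable_const _) (fun n => Eventually.of_forall fun t => ?_) ?_
  · have hanti : Antitone fun t : ℝ =>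
        (Measure.count : Measure (Fin n)).real {i | t < (min (w n i) M) ^ 3} :=
      fun a b hab => measureReal_mono (fun i hi => lt_of_le_of_lt hab hi)
    exact (hanti.measurable.div_const _).aestronglyMeasurable
  · rw [Real.norm_of_nonneg (by positivity)]
    refine div_le_one_of_le₀ ?_ (by positivity)
    calc (Measure.count : Measure (Fin n)).real {i | t < (min (w n i) M) ^ 3}
        ≤ (Measure.count : Measure (Fin n)).real univ := measureReal_mono (subset_univ _)
      _ = n := by simp [measureReal_def, Measure.count_apply]
  · have hnull := ((hcount.union (countable_singleton M)).image (fun u => u ^ 3)).ae_notMem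
      (volume.restrict (Ioc 0 (M ^ 3)))
    filter_upwards [hnull, ae_restrict_mem measurableSet_Ioc] with t ht htM
    obtain ⟨u, hu, rfl⟩ : ∃ u : ℝ, 0 ≤ u ∧ u ^ 3 = t :=
      ⟨t ^ ((3 : ℕ) : ℝ)⁻¹, Real.rpow_nonneg htM.1.le _,
        Real.rpow_inv_natCast_pow htM.1.le three_ne_zero⟩
    have hu' : u ∉ {x | ¬ ContinuousAt (fun y => (P {ω | W ω ≤ y}).toReal) x} ∪ {M} :=
      fun h => ht ⟨u, h, rfl⟩
    have huc : ContinuousAt (fun y => (P {ω | W ω ≤ y}).toReal) u := by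
      by_contra h
      exact hu' (Or.inl h)
    have huM : u < M := lt_of_le_of_ne
      ((pow_le_pow_iff_left₀ hu hM three_ne_zero).1 htM.2) fun h => hu' (Or.inr h)
    have hlim : P.real {ω | u ^ 3 < (min (W ω) M) ^ 3} =
        1 - (P {ω | W ω ≤ u}).toReal := by
      rw [← measureReal_def, ← probReal_compl_eq_one_sub (measurableSet_le hWmeas measurable_const)]
      congr 1
      ext ω
      simp only [mem_ofPred_eq, mem_compl_iff, not_le]
      exact pow_three_lt_min_pow_three_iff hu huM (hW ω)
    rw [hlim]
    refine ((hb u huc).const_sub 1).congr' ?_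
    filter_upwards [eventually_gt_atTop 0] with n hn
    have hset : {i | u ^ 3 < (min (w n i) M) ^ 3} =
        ((Finset.univ.filter fun i : Fin n => ¬ w n i ≤ u : Finset (Fin n)) : Set (Fin n)) := by
      ext i
      simp only [mem_ofPred_eq, Finset.coe_filter, Finset.mem_univ, true_and, not_le]
      exact pow_three_lt_min_pow_three_iff hu huM (hw n i)
    have hcard := Finset.card_filter_add_card_filter_not (s := (Finset.univ : Finset (Fin n)))
      (fun i => w n i ≤ u)
    rw [Finset.card_univ, Fintype.card_fin] at hcard
    have hn' : (n : ℝ) ≠ 0 := by positivity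
    rw [hset, measureReal_def, Measure.count_apply_finset, ENNReal.toReal_natCast, eq_div_iff hn',
      sub_mul, div_mul_cancel₀ _ hn', one_mul, sub_eq_iff_eq_add']
    exact_mod_cast hcard.symm

lemma tendsto_integral_min_pow_three {Ω : Type*} [MeasurableSpace Ω] (P : Measure Ω)
    (W : Ω → ℝ) (hWmeas : Measurable W) (hW : ∀ ω, 0 ≤ W ω)
    (hW3 : Integrable (fun ω => W ω ^ 3) P) :
    Tendsto (fun M : ℕ => ∫ ω, (min (W ω) M) ^ 3 ∂P) atTop (𝓝 (∫ ω, W ω ^ 3 ∂P)) := by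
  refine tendsto_integral_of_dominated_convergence (fun ω => W ω ^ 3)
    (fun M => ((hWmeas.min measurable_const).pow_const 3).aestronglyMeasurable) hW3
    (fun M => Eventually.of_forall fun ω => ?_) (Eventually.of_forall fun ω => ?_)
  · have h0 : 0 ≤ min (W ω) (M : ℝ) := le_min (hW ω) (Nat.cast_nonneg M)
    rw [Real.norm_of_nonneg (pow_nonneg h0 3)]
    exact pow_le_pow_left₀ h0 (min_le_left _ _) 3
  · refine tendsto_const_nhds.congr' ?_
    filter_upwards [eventually_ge_atTop ⌈W ω⌉₊] with M hM
    rw [min_eq_left (Nat.ceil_le.1 hM)]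

/-- A sum of cubes over a subfamily is at most the loss from truncating at `M` over the whole
family, plus `M ^ 3` for each member of the subfamily. -/
lemma sum_pow_three_le_of_card_le {ι : Type*} [Fintype ι] (a : ι → ℝ) (ha : ∀ i, 0 ≤ a i)
    {M : ℝ} (hM : 0 ≤ M) (S : Finset ι) :
    ∑ i ∈ S, a i ^ 3 ≤ ∑ i, a i ^ 3 - ∑ i, (min (a i) M) ^ 3 + S.card * M ^ 3 := by
  have hmin : ∀ i, 0 ≤ min (a i) M := fun i => le_min (ha i) hM
  have hloss : ∑ i ∈ S, (a i ^ 3 - (min (a i) M) ^ 3) ≤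
      ∑ i, (a i ^ 3 - (min (a i) M) ^ 3) :=
    Finset.sum_le_univ_sum_of_nonneg fun i =>
      sub_nonneg.2 (pow_le_pow_left₀ (hmin i) (min_le_left _ _) 3)
  have htrunc : ∑ i ∈ S, (min (a i) M) ^ 3 ≤ S.card * M ^ 3 := by
    rw [← nsmul_eq_mul]
    exact Finset.sum_le_card_nsmul _ _ _ fun i _ =>
      pow_le_pow_left₀ (hmin i) (min_le_right _ _) 3
  rw [Finset.sum_sub_distrib, Finset.sum_sub_distrib] at hloss
  linarith

lemma tendsto_floor_mul_rpow_div (s : ℝ) (hs : 0 ≤ s) :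
    Tendsto (fun n : ℕ => (⌊s * (n : ℝ) ^ (2/3 : ℝ)⌋₊ : ℝ) / n) atTop (𝓝 0) := by
  have hpow : Tendsto (fun n : ℕ => s * (n : ℝ) ^ (-(1/3 : ℝ))) atTop (𝓝 0) := by
    simpa using ((tendsto_rpow_neg_atTop (by norm_num : (0 : ℝ) < 1/3)).comp
      tendsto_natCast_atTop_atTop).const_mul s
  refine squeeze_zero' (Eventually.of_forall fun n => by positivity) ?_ hpow
  filter_upwards [eventually_gt_atTop 0] with n hn
  have hn' : (0 : ℝ) < n := Nat.cast_pos.2 hn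
  rw [div_le_iff₀ hn', mul_assoc, ← Real.rpow_add_one hn'.ne']
  norm_num
  exact Nat.floor_le (by positivity)

/-- Under conditions (b) and (c), with decreasingly ordered weights, for every `s > 0`
the sum of the cubes of the largest `⌊s n^{2/3}⌋` weights is `o(n)`:
`(1/n) ∑_{j ≤ ⌊s n^{2/3}⌋} w j³ → 0` as `n → ∞`. -/
theorem largest_weights_cube_sum_little_o
    -- the weight sequence scheme
    (w : ∀ n : ℕ, Fin n → ℝ) (hwpos : ∀ n (i : Fin n), 0 < w n i)
    -- the limiting random variable W
    {Ω₀ : Type*} [MeasurableSpace Ω₀] (P₀ : Measure Ω₀) [IsProbabilityMeasure P₀]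
    (W : Ω₀ → ℝ) (hWmeas : Measurable W) (hWnn : ∀ ω, 0 ≤ W ω)
    (hW1 : Integrable W P₀) (hW2 : Integrable (fun ω => W ω ^ 2) P₀)
    (hW3 : Integrable (fun ω => W ω ^ 3) P₀)
    (hμpos : 0 < ∫ ω, W ω ∂P₀)
    -- condition (b): weak convergence of the weight of a uniform vertex
    (hb : ∀ x : ℝ, ContinuousAt (fun y => (P₀ {ω | W ω ≤ y}).toReal) x →
      Tendsto (fun n : ℕ =>
          ((Finset.univ.filter fun i : Fin n => w n i ≤ x).card : ℝ) / n)
        atTop (𝓝 ((P₀ {ω | W ω ≤ x}).toReal)))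
    -- condition (c): convergence of the first three moments
    (hc1 : (fun n : ℕ => (∑ i : Fin n, w n i) / n - ∫ ω, W ω ∂P₀)
      =o[atTop] fun n : ℕ => (n : ℝ) ^ (-(1/3 : ℝ)))
    (hc2 : (fun n : ℕ => (∑ i : Fin n, (w n i) ^ 2) / n - ∫ ω, W ω ^ 2 ∂P₀)
      =o[atTop] fun n : ℕ => (n : ℝ) ^ (-(1/3 : ℝ)))
    (hc3 : Tendsto (fun n : ℕ => (∑ i : Fin n, (w n i) ^ 3) / n) atTop
      (𝓝 (∫ ω, W ω ^ 3 ∂P₀)))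
    -- the weights are ordered decreasingly
    (hdec : ∀ n : ℕ, ∀ i j : Fin n, i ≤ j → w n j ≤ w n i) :
    ∀ s : ℝ, 0 < s →
      Tendsto (fun n : ℕ =>
          (∑ i ∈ Finset.univ.filter
              (fun i : Fin n => (i : ℕ) < ⌊s * (n : ℝ) ^ (2/3 : ℝ)⌋₊),
            (w n i) ^ 3) / n)
        atTop (𝓝 0) := by
  intro s hs
  have hbound : ∀ (M n : ℕ),
      (∑ i ∈ Finset.univ.filter (fun i : Fin n => (i : ℕ) < ⌊s * (n : ℝ) ^ (2/3 : ℝ)⌋₊),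
        (w n i) ^ 3) / (n : ℝ) ≤
      (∑ i : Fin n, (w n i) ^ 3) / n - (∑ i : Fin n, (min (w n i) M) ^ 3) / n +
        (⌊s * (n : ℝ) ^ (2/3 : ℝ)⌋₊ : ℝ) / n * (M : ℝ) ^ 3 := by
    intro M n
    have hcard : (Finset.univ.filter
        (fun i : Fin n => (i : ℕ) < ⌊s * (n : ℝ) ^ (2/3 : ℝ)⌋₊)).card ≤
        ⌊s * (n : ℝ) ^ (2/3 : ℝ)⌋₊ := by
      rw [Fin.card_filter_val_lt]
      exact min_le_right _ _
    have hsum := sum_pow_three_le_of_card_le (w n) (fun i => (hwpos n i).le)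
      (Nat.cast_nonneg M) (Finset.univ.filter
        (fun i : Fin n => (i : ℕ) < ⌊s * (n : ℝ) ^ (2/3 : ℝ)⌋₊))
    rw [div_mul_eq_mul_div, ← sub_div, ← add_div]
    gcongr
    refine hsum.trans ?_
    gcongr
  have hlim : ∀ M : ℕ, Tendsto (fun n : ℕ =>
      (∑ i : Fin n, (w n i) ^ 3) / n - (∑ i : Fin n, (min (w n i) M) ^ 3) / n +
        (⌊s * (n : ℝ) ^ (2/3 : ℝ)⌋₊ : ℝ) / n * (M : ℝ) ^ 3) atTop
      (𝓝 (∫ ω, W ω ^ 3 ∂P₀ - ∫ ω, (min (W ω) M) ^ 3 ∂P₀)) := by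
    intro M
    simpa using (hc3.sub (tendsto_sum_min_pow_three_div w (fun n i => (hwpos n i).le) P₀ W hWmeas
      hWnn hb (Nat.cast_nonneg M))).add ((tendsto_floor_mul_rpow_div s hs.le).mul_const _)
  refine tendsto_order.2 ⟨fun a ha => Eventually.of_forall fun n => ha.trans_le ?_,
    fun ε hε => ?_⟩
  · exact div_nonneg (Finset.sum_nonneg fun i _ => pow_nonneg (hwpos n i).le 3)
      (Nat.cast_nonneg n)
  · have htrunc := (tendsto_integral_min_pow_three P₀ W hWmeas hWnn hW3).const_sub
      (∫ ω, W ω ^ 3 ∂P₀)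
    rw [sub_self] at htrunc
    obtain ⟨M, hM⟩ := (htrunc.eventually_lt_const hε).exists
    filter_upwards [(hlim M).eventually_lt_const hM] with n hn
    exact (hbound M n).trans_lt hn
end

section
/- (Verification of condition (c) for deterministic quantile weights.) Let W be a nonnegative random variable with distribution function F and E[W³] < ∞, and for each n define w_i = [1−F]^{-1}(i/n) for i = 1, …, n, where [1−F]^{-1}(u) = inf{ s ≥ 0 : 1 − F(s) ≤ u } for u ∈ (0,1) and [1−F]^{-1}(1) = 0. Then: (1/n)∑_{i=1}^{n} w_i = E[W] + o(n^{−1/3}), (1/n)∑_{i=1}^{n} w_i² = E[W²] + o(n^{−1/3}), and (1/n)∑_{i=1}^{n} w_i³ = E[W³] + o(1), as n → ∞. -/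
open MeasureTheory ProbabilityTheory Filter Set
open scoped ENNReal Topology

/-- The deterministic quantile weights `w i = [1-F]⁻¹(i/n)`, `i = 1, …, n`, where
`[1-F]⁻¹(u) = inf {s ≥ 0 : 1 - F s ≤ u}` and `F x = P(W ≤ x)`. (For `u = 1` the
infimum is `0`, matching the convention `[1-F]⁻¹(1) = 0`.) -/
noncomputable def quantileWeight {Ω : Type*} [MeasurableSpace Ω] (P : Measure Ω)
    (W : Ω → ℝ) (n : ℕ) (i : Fin n) : ℝ :=
  sInf {s : ℝ | 0 ≤ s ∧ 1 - (P {ω | W ω ≤ s}).toReal ≤ ((i : ℕ) + 1) / n}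

/-- The generalized inverse `u ↦ inf {s ≥ 0 : 1 - F s ≤ u}` of the tail of the distribution
function `F` of a measure on the real line. -/
noncomputable def tailQuantile (μ : Measure ℝ) (u : ℝ) : ℝ :=
  sInf {s : ℝ | 0 ≤ s ∧ 1 - cdf μ s ≤ u}

lemma tailQuantile_nonneg (μ : Measure ℝ) (u : ℝ) : 0 ≤ tailQuantile μ u :=
  Real.sInf_nonneg fun _ hs => hs.1

lemma nonempty_setOf_tail_le (μ : Measure ℝ) {u : ℝ} (hu : 0 < u) :
    {s : ℝ | 0 ≤ s ∧ 1 - cdf μ s ≤ u}.Nonempty := by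
  have h := (tendsto_cdf_atTop μ).eventually (eventually_ge_nhds (show 1 - u < 1 by linarith))
  obtain ⟨s, hs, hs0⟩ := (h.and (eventually_ge_atTop 0)).exists
  exact ⟨s, hs0, by linarith⟩

lemma bddBelow_setOf_tail_le (μ : Measure ℝ) (u : ℝ) :
    BddBelow {s : ℝ | 0 ≤ s ∧ 1 - cdf μ s ≤ u} :=
  ⟨0, fun _ hs => hs.1⟩

lemma antitoneOn_tailQuantile (μ : Measure ℝ) : AntitoneOn (tailQuantile μ) (Ioi 0) := by
  intro u hu v _ huv
  exact csInf_le_csInf (bddBelow_setOf_tail_le μ v) (nonempty_setOf_tail_le μ hu)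
    fun s hs => ⟨hs.1, hs.2.trans huv⟩

lemma tailQuantile_le_iff (μ : Measure ℝ) {u s : ℝ} (hu : 0 < u) (hs : 0 ≤ s) :
    tailQuantile μ u ≤ s ↔ 1 - cdf μ s ≤ u := by
  refine ⟨fun h => ?_, fun h => csInf_le (bddBelow_setOf_tail_le μ u) ⟨hs, h⟩⟩
  have key : ∀ t ∈ Ioi s, 1 - u ≤ cdf μ t := by
    intro t ht
    obtain ⟨a, ha, hat⟩ := exists_lt_of_csInf_lt (nonempty_setOf_tail_le μ hu) (h.trans_lt ht)
    have := monotone_cdf μ hat.le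
    linarith [ha.2]
  have hr : Tendsto (cdf μ) (𝓝[>] s) (𝓝 (cdf μ s)) :=
    ((cdf μ).right_continuous s).mono Ioi_subset_Ici_self
  have := ge_of_tendsto hr (eventually_mem_nhdsWithin.mono key)
  linarith

lemma aemeasurable_tailQuantile (μ : Measure ℝ) :
    AEMeasurable (tailQuantile μ) (volume.restrict (Ioc 0 1)) :=
  aemeasurable_restrict_of_antitoneOn measurableSet_Ioc
    ((antitoneOn_tailQuantile μ).mono fun _ h => h.1)

lemma map_tailQuantile (μ : Measure ℝ) [IsProbabilityMeasure μ] (hμ : μ (Iio 0) = 0) :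
    (volume.restrict (Ioc (0 : ℝ) 1)).map (tailQuantile μ) = μ := by
  have : IsProbabilityMeasure (volume.restrict (Ioc (0 : ℝ) 1)) := ⟨by simp⟩
  have hQ := aemeasurable_tailQuantile μ
  have := Measure.isProbabilityMeasure_map hQ
  refine Measure.ext_of_Iic _ _ fun s => ?_
  rw [Measure.map_apply_of_aemeasurable hQ measurableSet_Iic,
    Measure.restrict_apply₀' measurableSet_Ioc.nullMeasurableSet]
  rcases lt_or_ge s 0 with hs | hs
  · have h1 : tailQuantile μ ⁻¹' Iic s = ∅ := by
      ext u
      simpa using hs.trans_le (tailQuantile_nonneg μ u)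
    rw [h1, measure_mono_null (Iic_subset_Iio.2 hs) hμ]
    simp
  · have h1 : (tailQuantile μ ⁻¹' Iic s ∩ Ioc 0 1 : Set ℝ) =ᵐ[volume] Icc (1 - cdf μ s) 1 := by
      have h2 : (tailQuantile μ ⁻¹' Iic s ∩ Ioc 0 1 : Set ℝ) = Icc (1 - cdf μ s) 1 ∩ Ioi 0 := by
        ext u
        simp only [mem_inter_iff, mem_preimage, mem_Iic, mem_Ioc, mem_Icc, mem_Ioi]
        constructor
        · rintro ⟨h, h0, h1⟩
          exact ⟨⟨(tailQuantile_le_iff μ h0 hs).1 h, h1⟩, h0⟩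
        · rintro ⟨⟨h, h1⟩, h0⟩
          exact ⟨(tailQuantile_le_iff μ h0 hs).2 h, h0, h1⟩
      have h3 : (Icc (1 - cdf μ s) 1 : Set ℝ) = Icc (1 - cdf μ s) 1 ∩ Ici 0 := by
        rw [eq_comm, inter_eq_left]
        exact fun u hu => le_trans (by linarith [cdf_le_one μ s]) hu.1
      rw [h2]
      conv_rhs => rw [h3]
      exact (ae_eq_refl _).inter Ioi_ae_eq_Ici
    rw [measure_congr h1, Real.volume_Icc, sub_sub_cancel, ofReal_cdf]

lemma integral_tailQuantile_pow (μ : Measure ℝ) [IsProbabilityMeasure μ] (hμ : μ (Iio 0) = 0)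
    (p : ℕ) : ∫ u in (0 : ℝ)..1, tailQuantile μ u ^ p = ∫ x, x ^ p ∂μ := by
  rw [intervalIntegral.integral_of_le zero_le_one]
  conv_rhs => rw [← map_tailQuantile μ hμ]
  rw [integral_map (aemeasurable_tailQuantile μ) (by fun_prop)]

lemma intervalIntegrable_tailQuantile_pow (μ : Measure ℝ) [IsProbabilityMeasure μ]
    (hμ : μ (Iio 0) = 0) {p : ℕ} (h : Integrable (fun x => x ^ p) μ) :
    IntervalIntegrable (fun u => tailQuantile μ u ^ p) volume 0 1 := by
  rw [intervalIntegrable_iff_integrableOn_Ioc_of_le zero_le_one]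
  rw [← map_tailQuantile μ hμ, integrable_map_measure (by fun_prop)
    (aemeasurable_tailQuantile μ)] at h
  exact h

/-- The right Riemann sum of a nonnegative antitone function underestimates its integral by at
most the integral over the first cell. -/
lemma AntitoneOn.integral_sub_sum_mem_Icc {g : ℝ → ℝ} (hg : AntitoneOn g (Ioi 0))
    (hg0 : ∀ u, 0 ≤ g u) (hi : IntervalIntegrable g volume 0 1) {n : ℕ} (hn : 0 < n) :
    (∫ u in (0 : ℝ)..1, g u) - (∑ i : Fin n, g (((i : ℕ) + 1) / n)) / n ∈
      Icc 0 (∫ u in (0 : ℝ)..1 / n, g u) := by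
  obtain ⟨m, rfl⟩ : ∃ m, n = m + 1 := ⟨n - 1, by omega⟩
  set N : ℝ := ((m + 1 : ℕ) : ℝ) with hN
  have hNpos : 0 < N := by positivity
  let a : ℕ → ℝ := fun k => k / N
  have ha : ∀ k, a (k + 1) - a k = 1 / N := fun k => by simp only [a]; push_cast; ring
  have hmono : Monotone a := fun i j hij => by simp only [a]; gcongr
  have ha0 : a 0 = 0 := by simp [a]
  have ha1 : a (m + 1) = 1 := by simp only [a]; rw [← hN]; exact div_self hNpos.ne'
  have hapos : ∀ k, 0 < a (k + 1) := fun k => by simp only [a]; positivity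
  have hint : ∀ i j, i ≤ j → j ≤ m + 1 → IntervalIntegrable g volume (a i) (a j) := by
    intro i j hij hj
    refine hi.mono_set ?_
    rw [uIcc_of_le (hmono hij), uIcc_of_le zero_le_one, ← ha0, ← ha1]
    exact Icc_subset_Icc (hmono (Nat.zero_le _)) (hmono hj)
  have hlow : ∀ k, k < m + 1 → g (a (k + 1)) / N ≤ ∫ u in a k..a (k + 1), g u := by
    intro k hk
    have := intervalIntegral.integral_mono_on_of_le_Ioo (hmono k.le_succ)
      (intervalIntegrable_const (μ := volume) (c := g (a (k + 1)))) (hint k (k + 1) k.le_succ hk)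
      fun u hu => hg ((show 0 ≤ a k from ha0 ▸ hmono k.zero_le).trans_lt hu.1) (hapos k) hu.2.le
    rw [intervalIntegral.integral_const, ha, smul_eq_mul] at this
    linarith [show g (a (k + 1)) / N = 1 / N * g (a (k + 1)) by ring]
  have hup : ∀ k, k < m → ∫ u in a (k + 1)..a (k + 2), g u ≤ g (a (k + 1)) / N := by
    intro k hk
    have := intervalIntegral.integral_mono_on_of_le_Ioo (hmono (k + 1).le_succ)
      (hint (k + 1) (k + 2) (k + 1).le_succ (by omega))
      (intervalIntegrable_const (μ := volume) (c := g (a (k + 1))))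
      fun u hu => hg (hapos k) ((hapos k).trans hu.1) hu.1.le
    rw [intervalIntegral.integral_const, ha, smul_eq_mul] at this
    linarith [show g (a (k + 1)) / N = 1 / N * g (a (k + 1)) by ring]
  have hS : (∑ i : Fin (m + 1), g (((i : ℕ) + 1) / N)) / N
      = ∑ k ∈ Finset.range (m + 1), g (a (k + 1)) / N := by
    rw [Finset.sum_div, Fin.sum_univ_eq_sum_range (fun k : ℕ => g ((k + 1) / N) / N)]
    simp [a]
  have hcells : ∑ k ∈ Finset.range (m + 1), ∫ u in a k..a (k + 1), g u = ∫ u in (0 : ℝ)..1, g u := by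
    rw [intervalIntegral.sum_integral_adjacent_intervals
      fun k hk => hint k (k + 1) k.le_succ hk, ha0, ha1]
  have hfirst : a 1 = 1 / N := by simp [a]
  rw [hS]
  constructor
  · rw [← hcells, sub_nonneg]
    exact Finset.sum_le_sum fun k hk => hlow k (Finset.mem_range.1 hk)
  · rw [Finset.sum_range_succ]
    have h1 := Finset.sum_le_sum fun k hk => hup k (Finset.mem_range.1 hk)
    rw [Finset.sum_range_succ', ha0, zero_add, hfirst] at hcells
    have h2 : 0 ≤ g (a (m + 1)) / N := div_nonneg (hg0 _) hNpos.le
    simp only [add_assoc, one_add_one_eq_two] at hcells h1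
    linarith

lemma tendsto_integral_zero_one_div {g : ℝ → ℝ} (hi : IntervalIntegrable g volume 0 1) :
    Tendsto (fun n : ℕ => ∫ u in (0 : ℝ)..1 / n, g u) atTop (𝓝 0) := by
  have hc := intervalIntegral.continuousOn_primitive_interval'
    hi left_mem_uIcc 0 left_mem_uIcc
  have ht : Tendsto (fun n : ℕ => 1 / (n : ℝ)) atTop (𝓝[uIcc 0 1] 0) := by
    refine tendsto_nhdsWithin_iff.2 ⟨tendsto_one_div_atTop_nhds_zero_nat, ?_⟩
    filter_upwards [eventually_ge_atTop 1] with n hn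
    rw [uIcc_of_le zero_le_one]
    have : (1 : ℝ) ≤ n := by exact_mod_cast hn
    exact ⟨by positivity, (div_le_one (by positivity)).2 this⟩
  simpa [Function.comp_def] using hc.tendsto.comp ht

lemma IntervalIntegrable.zero_one_div_nat {g : ℝ → ℝ} (hi : IntervalIntegrable g volume 0 1)
    {n : ℕ} (hn : 0 < n) : IntervalIntegrable g volume 0 (1 / n) := by
  refine hi.mono_set ?_
  have : (1 : ℝ) ≤ n := by exact_mod_cast hn
  rw [uIcc_of_le (by positivity), uIcc_of_le zero_le_one]
  exact Icc_subset_Icc_right ((div_le_one (by positivity)).2 this)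

lemma isLittleO_integral_sq {f : ℝ → ℝ} (hf : ∀ u, 0 ≤ f u)
    (h2 : IntervalIntegrable (fun u => f u ^ 2) volume 0 1)
    (h3 : IntervalIntegrable (fun u => f u ^ 3) volume 0 1) :
    (fun n : ℕ => ∫ u in (0 : ℝ)..1 / n, f u ^ 2) =o[atTop]
      fun n : ℕ => (n : ℝ) ^ (-(1/3 : ℝ)) := by
  refine Asymptotics.isLittleO_iff.2 fun c hc => ?_
  obtain ⟨d, hd, hd1, hdc⟩ : ∃ d : ℝ, 0 < d ∧ d ≤ 1 ∧ d ≤ c / 2 :=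
    ⟨min 1 (c / 2), by positivity, min_le_left _ _, min_le_right _ _⟩
  filter_upwards [(tendsto_integral_zero_one_div h3).eventually
    (eventually_le_nhds (show 0 < c * d / 2 by positivity)), eventually_gt_atTop 0] with n hr hn
  have hn' : (0 : ℝ) < n := by exact_mod_cast hn
  have hle : (0 : ℝ) ≤ 1 / n := by positivity
  set y : ℝ := (n : ℝ) ^ (1/3 : ℝ) with hy
  have hypos : 0 < y := by positivity
  have hy3 : y ^ 3 = n := by
    rw [hy, ← Real.rpow_natCast, ← Real.rpow_mul hn'.le]; norm_num
  have hyoung : ∀ x : ℝ, 0 ≤ x → d * y * x ^ 2 ≤ x ^ 3 + d ^ 3 * n := by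
    intro x hx
    rw [← hy3, ← mul_pow]
    have hz : 0 ≤ d * y := by positivity
    generalize d * y = z at hz
    rcases le_total z x with h | h
    · nlinarith [mul_le_mul_of_nonneg_right h (sq_nonneg x), pow_nonneg hz 3]
    · nlinarith [mul_le_mul_of_nonneg_left (pow_le_pow_left₀ hx h 2) hz, pow_nonneg hx 3]
  have hI := intervalIntegral.integral_mono_on hle
    ((h2.zero_one_div_nat hn).const_mul (d * y))
    ((h3.zero_one_div_nat hn).add (intervalIntegrable_const (c := d ^ 3 * n)))
    fun u _ => hyoung (f u) (hf u)
  rw [intervalIntegral.integral_const_mul, intervalIntegral.integral_add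
    (h3.zero_one_div_nat hn) intervalIntegrable_const, intervalIntegral.integral_const,
    sub_zero, smul_eq_mul, show 1 / (n : ℝ) * (d ^ 3 * n) = d ^ 3 by field_simp] at hI
  have h0 : 0 ≤ ∫ u in (0 : ℝ)..1 / n, f u ^ 2 :=
    intervalIntegral.integral_nonneg hle fun u _ => sq_nonneg _
  rw [Real.norm_of_nonneg h0, Real.norm_of_nonneg (by positivity), Real.rpow_neg hn'.le, ← hy,
    ← div_eq_mul_inv, le_div_iff₀ hypos]
  have hd3 : d ^ 3 ≤ d * (c / 2) := by nlinarith [mul_pos hd hd]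
  refine le_of_mul_le_mul_left ?_ hd
  linarith

lemma isLittleO_integral_of_sq {f : ℝ → ℝ} (hf : ∀ u, 0 ≤ f u)
    (h1 : IntervalIntegrable f volume 0 1)
    (h2 : IntervalIntegrable (fun u => f u ^ 2) volume 0 1)
    (h3 : IntervalIntegrable (fun u => f u ^ 3) volume 0 1) :
    (fun n : ℕ => ∫ u in (0 : ℝ)..1 / n, f u) =o[atTop]
      fun n : ℕ => (n : ℝ) ^ (-(1/3 : ℝ)) := by
  have hinv : (fun n : ℕ => 1 / (n : ℝ)) =o[atTop] fun n : ℕ => (n : ℝ) ^ (-(1/3 : ℝ)) := by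
    have hlim := (tendsto_rpow_neg_atTop (show (0 : ℝ) < 2 / 3 by norm_num)).comp
      (tendsto_natCast_atTop_atTop (R := ℝ))
    refine (Asymptotics.isLittleO_iff_tendsto' ?_).2 (hlim.congr' ?_)
    · filter_upwards [eventually_gt_atTop 0] with n hn h
      have hn' : (0 : ℝ) < n := by exact_mod_cast hn
      exact absurd h (Real.rpow_pos_of_pos hn' _).ne'
    · filter_upwards [eventually_gt_atTop 0] with n hn
      have hn' : (0 : ℝ) < n := by exact_mod_cast hn
      rw [one_div, ← Real.rpow_neg_one, ← Real.rpow_sub hn', Function.comp_apply]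
      norm_num
  refine Asymptotics.IsBigO.trans_isLittleO ?_ (hinv.add (isLittleO_integral_sq hf h2 h3))
  refine Asymptotics.IsBigO.of_bound' ?_
  filter_upwards [eventually_gt_atTop 0] with n hn
  have hle : (0 : ℝ) ≤ 1 / n := by positivity
  have hI := intervalIntegral.integral_mono_on hle (h1.zero_one_div_nat hn)
    ((intervalIntegrable_const (c := (1 : ℝ))).add (h2.zero_one_div_nat hn))
    fun u _ => show f u ≤ 1 + f u ^ 2 by nlinarith [sq_nonneg (f u - 1), hf u]
  rw [intervalIntegral.integral_add intervalIntegrable_const (h2.zero_one_div_nat hn),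
    intervalIntegral.integral_const, sub_zero, smul_eq_mul, mul_one] at hI
  rw [Real.norm_of_nonneg (intervalIntegral.integral_nonneg hle fun u _ => hf u)]
  exact hI.trans (le_abs_self _)

lemma quantileWeight_eq_tailQuantile {Ω : Type*} [MeasurableSpace Ω] (P : Measure Ω)
    [IsProbabilityMeasure P] {W : Ω → ℝ} (hW : Measurable W) (n : ℕ) (i : Fin n) :
    quantileWeight P W n i = tailQuantile (P.map W) (((i : ℕ) + 1) / n) := by
  have := Measure.isProbabilityMeasure_map (μ := P) hW.aemeasurable
  simp only [quantileWeight, tailQuantile, cdf_eq_real, measureReal_def,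
    Measure.map_apply hW measurableSet_Iic]
  rfl

lemma map_Iio_zero_eq_zero {Ω : Type*} [MeasurableSpace Ω] (P : Measure Ω) {W : Ω → ℝ}
    (hW : Measurable W) (hnn : ∀ ω, 0 ≤ W ω) : P.map W (Iio 0) = 0 := by
  rw [Measure.map_apply hW measurableSet_Iio]
  convert measure_empty (μ := P)
  ext ω
  simpa using hnn ω

/-- The error of the `p`-th empirical moment of the quantile weights is controlled by the integral
of the `p`-th power of the tail quantile function over `(0, 1/n)`. -/
lemma norm_sum_quantileWeight_pow_sub_le {Ω : Type*} [MeasurableSpace Ω] (P : Measure Ω)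
    [IsProbabilityMeasure P] {W : Ω → ℝ} (hW : Measurable W) (hnn : ∀ ω, 0 ≤ W ω) {p : ℕ}
    (hi : IntervalIntegrable (fun u => tailQuantile (P.map W) u ^ p) volume 0 1)
    {n : ℕ} (hn : 0 < n) :
    ‖(∑ i : Fin n, quantileWeight P W n i ^ p) / n - ∫ ω, W ω ^ p ∂P‖ ≤
      ∫ u in (0 : ℝ)..1 / n, tailQuantile (P.map W) u ^ p := by
  have := Measure.isProbabilityMeasure_map (μ := P) hW.aemeasurable
  have hμ := map_Iio_zero_eq_zero P hW hnn
  have hanti : AntitoneOn (fun u => tailQuantile (P.map W) u ^ p) (Ioi 0) := fun u hu v hv huv =>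
    pow_le_pow_left₀ (tailQuantile_nonneg _ _) (antitoneOn_tailQuantile _ hu hv huv) p
  have key := hanti.integral_sub_sum_mem_Icc (fun u => pow_nonneg (tailQuantile_nonneg _ u) p) hi hn
  rw [integral_tailQuantile_pow _ hμ, integral_map hW.aemeasurable (by fun_prop)] at key
  simp only [quantileWeight_eq_tailQuantile P hW]
  rw [norm_sub_rev, Real.norm_of_nonneg key.1]
  exact key.2

/-- Verification of condition (c) for deterministic quantile weights: if `W` is a
nonnegative random variable with `E[W³] < ∞` and `w n i = [1-F]⁻¹(i/n)`, then
`(1/n) ∑ᵢ w n i = E[W] + o(n^{-1/3})`, `(1/n) ∑ᵢ (w n i)² = E[W²] + o(n^{-1/3})` and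
`(1/n) ∑ᵢ (w n i)³ = E[W³] + o(1)`. -/
theorem quantile_weights_condition_c
    {Ω : Type*} [MeasurableSpace Ω] (P : Measure Ω) [IsProbabilityMeasure P]
    (W : Ω → ℝ) (hWmeas : Measurable W) (hWnn : ∀ ω, 0 ≤ W ω)
    (hW1 : Integrable W P) (hW2 : Integrable (fun ω => W ω ^ 2) P)
    (hW3 : Integrable (fun ω => W ω ^ 3) P) :
    ((fun n : ℕ => (∑ i : Fin n, quantileWeight P W n i) / n - ∫ ω, W ω ∂P)
        =o[atTop] fun n : ℕ => (n : ℝ) ^ (-(1/3 : ℝ)))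
    ∧ ((fun n : ℕ => (∑ i : Fin n, (quantileWeight P W n i) ^ 2) / n - ∫ ω, W ω ^ 2 ∂P)
        =o[atTop] fun n : ℕ => (n : ℝ) ^ (-(1/3 : ℝ)))
    ∧ Tendsto (fun n : ℕ => (∑ i : Fin n, (quantileWeight P W n i) ^ 3) / n) atTop
        (𝓝 (∫ ω, W ω ^ 3 ∂P)) := by
  have hprob := Measure.isProbabilityMeasure_map (μ := P) hWmeas.aemeasurable
  have hμ := map_Iio_zero_eq_zero P hWmeas hWnn
  have hint : ∀ p : ℕ, Integrable (fun ω => W ω ^ p) P →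
      IntervalIntegrable (fun u => tailQuantile (P.map W) u ^ p) volume 0 1 := fun p hp =>
    intervalIntegrable_tailQuantile_pow _ hμ
      ((integrable_map_measure (by fun_prop) hWmeas.aemeasurable).2 hp)
  have h1 := hint 1 (by simpa using hW1)
  have h2 := hint 2 hW2
  have h3 := hint 3 hW3
  have hQ := tailQuantile_nonneg (P.map W)
  have hbound : ∀ p : ℕ, IntervalIntegrable (fun u => tailQuantile (P.map W) u ^ p) volume 0 1 →
      ∀ᶠ n : ℕ in atTop, ‖(∑ i : Fin n, quantileWeight P W n i ^ p) / n - ∫ ω, W ω ^ p ∂P‖ ≤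
        ∫ u in (0 : ℝ)..1 / n, tailQuantile (P.map W) u ^ p := fun p hp =>
    (eventually_gt_atTop 0).mono fun n hn =>
      norm_sum_quantileWeight_pow_sub_le P hWmeas hWnn hp hn
  refine ⟨?_, ?_, ?_⟩
  · have hb := hbound 1 h1
    simp only [pow_one] at hb h1
    exact (Asymptotics.IsBigO.of_bound' (hb.mono fun n hn => hn.trans (le_abs_self _))).trans_isLittleO
      (isLittleO_integral_of_sq hQ h1 h2 h3)
  · exact (Asymptotics.IsBigO.of_bound'
      ((hbound 2 h2).mono fun n hn => hn.trans (le_abs_self _))).trans_isLittleO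
      (isLittleO_integral_sq hQ h2 h3)
  · exact tendsto_iff_norm_sub_tendsto_zero.2
      (squeeze_zero' (Eventually.of_forall fun _ => norm_nonneg _) (hbound 3 h3)
        (tendsto_integral_zero_one_div h3))
end
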